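/- Inductive step for the m-layer sensitivity bound: under the Lipschitz assumptions on up, rs, mp, F as in the one-layer bound, if for every coordinate pair the bound |∂h_v^{ℓ,α}/∂h_u^{0,β}| ≤ c_up^ℓ·((c_rs·I + c_mp·(c_F·k_h + k_F)·A)^ℓ)_{vu} holds at layer ℓ, then it also holds at layer ℓ+1 with exponent ℓ+1. Consequently, for an m-layer network, ‖∂h_v^{(m)}/∂h_u^{(0)}‖_{L¹} ≤ d·((c_up·(c_rs·I + c_mp·(c_F·k_h + k_F)·A))^m)_{vu}. -/

import Mathlib

/-- One layer of filtered message passing. -/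
def ampLayer {V : Type*} [Fintype V] {d : ℕ}
    (up rs mp : (Fin d → ℝ) → (Fin d → ℝ)) (F : (Fin d → ℝ) → (Fin d → ℝ))
    (A : Matrix V V ℝ) (h : V → Fin d → ℝ) (v : V) : Fin d → ℝ :=
  up (rs (h v) + mp (fun q => ∑ u, A v u * (F (h u) q * h u q)))

/-- `ℓ` layers of filtered message passing. -/
def ampIter {V : Type*} [Fintype V] {d : ℕ}
    (up rs mp : (Fin d → ℝ) → (Fin d → ℝ)) (F : (Fin d → ℝ) → (Fin d → ℝ))
    (A : Matrix V V ℝ) : ℕ → (V → Fin d → ℝ) → V → Fin d → ℝ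
  | 0, h => h
  | ℓ + 1, h => ampLayer up rs mp F A (ampIter up rs mp F A ℓ h)

/-- A row sum bound for a linear map transfers to families of vectors bounded coordinatewise in
summed absolute value. -/
theorem sum_abs_apply_le {d : ℕ} {ι : Type*} [Fintype ι]
    (L : (Fin d → ℝ) →L[ℝ] (Fin d → ℝ)) (p : Fin d) {c B : ℝ}
    (hL : ∑ q, |L (Pi.single q 1) p| ≤ c) (x : ι → Fin d → ℝ)
    (hx : ∀ q, ∑ i, |x i q| ≤ B) :
    ∑ i, |L (x i) p| ≤ c * B := by
  have hB : 0 ≤ B := (Finset.sum_nonneg fun i _ => abs_nonneg (x i p)).trans (hx p)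
  have hexp : ∀ y : Fin d → ℝ, L y p = ∑ q, y q * L (Pi.single q 1) p := by
    intro y
    conv_lhs => rw [pi_eq_sum_univ' y]
    simp [Finset.sum_apply]
  calc ∑ i, |L (x i) p|
      ≤ ∑ i, ∑ q, |L (Pi.single q 1) p| * |x i q| := by
        refine Finset.sum_le_sum fun i _ => ?_
        rw [hexp]
        refine (Finset.abs_sum_le_sum_abs _ _).trans_eq ?_
        simp_rw [abs_mul, mul_comm]
    _ = ∑ q, |L (Pi.single q 1) p| * ∑ i, |x i q| := by
        rw [Finset.sum_comm]
        simp_rw [Finset.mul_sum]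
    _ ≤ ∑ q, |L (Pi.single q 1) p| * B := by
        gcongr with q
        exact hx q
    _ ≤ c * B := by
        rw [← Finset.sum_mul]
        gcongr

/-- The derivative of one layer, coordinate by coordinate. -/
theorem hasFDerivAt_ampLayer {V : Type*} [Fintype V] {d : ℕ}
    {up rs mp F : (Fin d → ℝ) → (Fin d → ℝ)} (A : Matrix V V ℝ)
    (hup : Differentiable ℝ up) (hrs : Differentiable ℝ rs)
    (hmp : Differentiable ℝ mp) (hF : Differentiable ℝ F) (x : V → Fin d → ℝ) (v : V) :
    HasFDerivAt (fun h : V → Fin d → ℝ => ampLayer up rs mp F A h v)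
      ((fderiv ℝ up (rs (x v) + mp (fun q => ∑ u, A v u * (F (x u) q * x u q)))).comp
        ((fderiv ℝ rs (x v)).comp (ContinuousLinearMap.proj v) +
          (fderiv ℝ mp (fun q => ∑ u, A v u * (F (x u) q * x u q))).comp
            (ContinuousLinearMap.pi fun q => ∑ u, A v u •
              (F (x u) q • (ContinuousLinearMap.proj (R := ℝ) (φ := fun _ : Fin d => ℝ) q).comp
            (ContinuousLinearMap.proj u) +
                x u q • (ContinuousLinearMap.proj (R := ℝ) (φ := fun _ : Fin d => ℝ) q).comp
                  ((fderiv ℝ F (x u)).comp (ContinuousLinearMap.proj u)))))) x := by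
  have hproj : ∀ u : V, HasFDerivAt (fun h : V → Fin d → ℝ => h u)
      (ContinuousLinearMap.proj (R := ℝ) (φ := fun _ : V => Fin d → ℝ) u) x :=
    fun u => hasFDerivAt_apply u x
  have hcoord : ∀ (u : V) (q : Fin d), HasFDerivAt (fun h : V → Fin d → ℝ => h u q)
      ((ContinuousLinearMap.proj (R := ℝ) (φ := fun _ : Fin d => ℝ) q).comp
            (ContinuousLinearMap.proj u)) x :=
    fun u q => hasFDerivAt_pi'.1 (hproj u) q
  have hFcoord : ∀ (u : V) (q : Fin d), HasFDerivAt (fun h : V → Fin d → ℝ => F (h u) q)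
      ((ContinuousLinearMap.proj (R := ℝ) (φ := fun _ : Fin d => ℝ) q).comp
        ((fderiv ℝ F (x u)).comp (ContinuousLinearMap.proj u))) x :=
    fun u q => hasFDerivAt_pi'.1 ((hF (x u)).hasFDerivAt.comp x (hproj u)) q
  have hmsg : HasFDerivAt
      (fun (h : V → Fin d → ℝ) (q : Fin d) => ∑ u, A v u * (F (h u) q * h u q))
      (ContinuousLinearMap.pi fun q => ∑ u, A v u •
        (F (x u) q • (ContinuousLinearMap.proj (R := ℝ) (φ := fun _ : Fin d => ℝ) q).comp
            (ContinuousLinearMap.proj u) +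
          x u q • (ContinuousLinearMap.proj (R := ℝ) (φ := fun _ : Fin d => ℝ) q).comp
            ((fderiv ℝ F (x u)).comp (ContinuousLinearMap.proj u)))) x :=
    hasFDerivAt_pi.2 fun q => HasFDerivAt.fun_sum fun u _ =>
      ((hFcoord u q).mul (hcoord u q)).const_mul (A v u)
  exact (hup _).hasFDerivAt.comp x
    (((hrs (x v)).hasFDerivAt.comp x (hproj v)).add ((hmp _).hasFDerivAt.comp x hmsg))

theorem differentiable_ampLayer {V : Type*} [Fintype V] {d : ℕ}
    {up rs mp F : (Fin d → ℝ) → (Fin d → ℝ)} (A : Matrix V V ℝ)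
    (hup : Differentiable ℝ up) (hrs : Differentiable ℝ rs)
    (hmp : Differentiable ℝ mp) (hF : Differentiable ℝ F) :
    Differentiable ℝ (ampLayer up rs mp F A) :=
  differentiable_pi.2 fun v x => (hasFDerivAt_ampLayer A hup hrs hmp hF x v).differentiableAt

theorem differentiable_ampIter {V : Type*} [Fintype V] {d : ℕ}
    {up rs mp F : (Fin d → ℝ) → (Fin d → ℝ)} (A : Matrix V V ℝ)
    (hup : Differentiable ℝ up) (hrs : Differentiable ℝ rs)
    (hmp : Differentiable ℝ mp) (hF : Differentiable ℝ F) (ℓ : ℕ) :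
    Differentiable ℝ (ampIter up rs mp F A ℓ) := by
  induction ℓ with
  | zero => exact differentiable_id
  | succ ℓ ih => exact (differentiable_ampLayer A hup hrs hmp hF).comp ih

theorem fderiv_ampIter_succ {V : Type*} [Fintype V] {d : ℕ}
    {up rs mp F : (Fin d → ℝ) → (Fin d → ℝ)} (A : Matrix V V ℝ)
    (hup : Differentiable ℝ up) (hrs : Differentiable ℝ rs)
    (hmp : Differentiable ℝ mp) (hF : Differentiable ℝ F) (ℓ : ℕ) (x w : V → Fin d → ℝ) :
    fderiv ℝ (ampIter up rs mp F A (ℓ + 1)) x w =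
      fderiv ℝ (ampLayer up rs mp F A) (ampIter up rs mp F A ℓ x)
        (fderiv ℝ (ampIter up rs mp F A ℓ) x w) := by
  have h := fderiv_comp x (differentiable_ampLayer A hup hrs hmp hF _)
    (differentiable_ampIter A hup hrs hmp hF ℓ x)
  exact congrArg (fun L => L w) h

theorem fderiv_apply_apply {V : Type*} [Fintype V] {d : ℕ}
    {f : (V → Fin d → ℝ) → V → Fin d → ℝ} {x : V → Fin d → ℝ}
    (hf : DifferentiableAt ℝ f x) (v : V) (p : Fin d) (w : V → Fin d → ℝ) :
    fderiv ℝ (fun h => f h v p) x w = fderiv ℝ f x w v p := by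
  have h := hasFDerivAt_pi'.1 (hasFDerivAt_pi'.1 hf.hasFDerivAt v) p
  rw [h.fderiv]
  rfl

/-- One layer amplifies coordinatewise bounds on a family of tangent vectors at most by the matrix
`c_up (c_rs I + c_mp (c_F k_h + k_F) A)`. -/
theorem sum_abs_fderiv_ampLayer_le {V : Type*} [Fintype V] [DecidableEq V] {d : ℕ}
    {up rs mp F : (Fin d → ℝ) → (Fin d → ℝ)} (A : Matrix V V ℝ) (hA : ∀ v u, 0 ≤ A v u)
    {cup crs cmp cF kh kF : ℝ}
    (hupDiff : Differentiable ℝ up) (hrsDiff : Differentiable ℝ rs)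
    (hmpDiff : Differentiable ℝ mp) (hFDiff : Differentiable ℝ F)
    (hup : ∀ (y : Fin d → ℝ) (p : Fin d), ∑ q, |fderiv ℝ up y (Pi.single q 1) p| ≤ cup)
    (hrs : ∀ (y : Fin d → ℝ) (p : Fin d), ∑ q, |fderiv ℝ rs y (Pi.single q 1) p| ≤ crs)
    (hmp : ∀ (y : Fin d → ℝ) (p : Fin d), ∑ q, |fderiv ℝ mp y (Pi.single q 1) p| ≤ cmp)
    (hF : ∀ y : Fin d → ℝ, ∑ p, ∑ q, |fderiv ℝ F y (Pi.single q 1) p| ≤ cF)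
    (hFrange : ∀ (y : Fin d → ℝ) (q : Fin d), |F y q| ≤ kF)
    (x : V → Fin d → ℝ) (hkh : ∀ u q, |x u q| ≤ kh)
    {ι : Type*} [Fintype ι] (w : ι → V → Fin d → ℝ) (B : V → ℝ)
    (hw : ∀ u q, ∑ i, |w i u q| ≤ B u) (v : V) (p : Fin d) :
    ∑ i, |fderiv ℝ (ampLayer up rs mp F A) x (w i) v p| ≤
      cup * ∑ u, (crs • (1 : Matrix V V ℝ) + (cmp * (cF * kh + kF)) • A) v u * B u := by
  have hFrow : ∀ (y : Fin d → ℝ) (q : Fin d), ∑ r, |fderiv ℝ F y (Pi.single r 1) q| ≤ cF :=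
    fun y q => (Finset.single_le_sum
      (f := fun q => ∑ r, |fderiv ℝ F y (Pi.single r 1) q|)
      (fun q _ => Finset.sum_nonneg fun r _ => abs_nonneg _) (Finset.mem_univ q)).trans (hF y)
  have hrhs : ∑ u, (crs • (1 : Matrix V V ℝ) + (cmp * (cF * kh + kF)) • A) v u * B u =
      crs * B v + cmp * ∑ u, A v u * ((kF + kh * cF) * B u) := by
    simp only [Matrix.add_apply, Matrix.smul_apply, Matrix.one_apply, smul_eq_mul, add_mul,
      Finset.sum_add_distrib, mul_ite, mul_one, mul_zero, ite_mul, zero_mul, Finset.sum_ite_eq,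
      Finset.mem_univ, if_true, Finset.mul_sum, mul_add]
    rw [← Finset.sum_add_distrib, ← Finset.sum_add_distrib]
    congr 1
    refine Finset.sum_congr rfl fun u _ => ?_
    ring
  rw [hrhs]
  have hfd : ∀ i, fderiv ℝ (ampLayer up rs mp F A) x (w i) v =
      fderiv ℝ (fun h => ampLayer up rs mp F A h v) x (w i) := by
    intro i
    have h := hasFDerivAt_pi'.1
      (differentiable_ampLayer A hupDiff hrsDiff hmpDiff hFDiff x).hasFDerivAt v
    rw [h.fderiv]
    rfl
  simp_rw [hfd, (hasFDerivAt_ampLayer A hupDiff hrsDiff hmpDiff hFDiff x v).fderiv]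
  simp only [ContinuousLinearMap.comp_apply, add_apply, ContinuousLinearMap.proj_apply]
  refine sum_abs_apply_le _ p (hup _ p) (fun i => _) fun r => ?_
  refine (Finset.sum_le_sum fun i _ => abs_add_le _ _).trans ?_
  rw [Finset.sum_add_distrib]
  refine add_le_add (sum_abs_apply_le _ r (hrs _ r) (fun i => w i v) (hw v)) ?_
  refine sum_abs_apply_le _ r (hmp _ r) (fun i => _) fun q => ?_
  have hcoord : ∀ u, ∑ i, |F (x u) q * w i u q + x u q * fderiv ℝ F (x u) (w i u) q| ≤
      (kF + kh * cF) * B u := by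
    intro u
    calc ∑ i, |F (x u) q * w i u q + x u q * fderiv ℝ F (x u) (w i u) q|
        ≤ ∑ i, (|F (x u) q| * |w i u q| + |x u q| * |fderiv ℝ F (x u) (w i u) q|) := by
          refine Finset.sum_le_sum fun i _ => (abs_add_le _ _).trans_eq ?_
          rw [abs_mul, abs_mul]
      _ = |F (x u) q| * ∑ i, |w i u q| + |x u q| * ∑ i, |fderiv ℝ F (x u) (w i u) q| := by
          rw [Finset.sum_add_distrib, Finset.mul_sum, Finset.mul_sum]
      _ ≤ kF * B u + kh * (cF * B u) := by
          have hkh0 : 0 ≤ kh := (abs_nonneg _).trans (hkh u q)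
          have hkF0 : 0 ≤ kF := (abs_nonneg _).trans (hFrange (x u) q)
          exact add_le_add
            (mul_le_mul (hFrange _ q) (hw u q)
              (Finset.sum_nonneg fun i _ => abs_nonneg _) hkF0)
            (mul_le_mul (hkh u q)
              (sum_abs_apply_le _ q (hFrow (x u) q) (fun i => w i u) (hw u))
              (Finset.sum_nonneg fun i _ => abs_nonneg _) hkh0)
      _ = (kF + kh * cF) * B u := by ring
  simp only [ContinuousLinearMap.coe_pi', sum_apply,
    smul_apply, add_apply,
    ContinuousLinearMap.comp_apply, ContinuousLinearMap.proj_apply, smul_eq_mul]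
  calc ∑ i, |∑ u, A v u * (F (x u) q * w i u q + x u q * fderiv ℝ F (x u) (w i u) q)|
      ≤ ∑ i, ∑ u, A v u * |F (x u) q * w i u q + x u q * fderiv ℝ F (x u) (w i u) q| := by
        refine Finset.sum_le_sum fun i _ => (Finset.abs_sum_le_sum_abs _ _).trans_eq ?_
        simp_rw [abs_mul (A v _), abs_of_nonneg (hA v _)]
    _ = ∑ u, A v u * ∑ i, |F (x u) q * w i u q + x u q * fderiv ℝ F (x u) (w i u) q| := by
        rw [Finset.sum_comm]
        simp_rw [Finset.mul_sum]
    _ ≤ ∑ u, A v u * ((kF + kh * cF) * B u) :=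
        Finset.sum_le_sum fun u _ => mul_le_mul_of_nonneg_left (hcoord u) (hA v u)

/-- Inductive step for the `m`-layer sensitivity bound, and the resulting
`m`-layer bound `‖∂h_v^{(m)}/∂h_u^{(0)}‖_{L¹} ≤ d ((c_up (c_rs I + c_mp (c_F k_h + k_F) A))^m)_{vu}`. -/
theorem multi_layer_sensitivity_bound {V : Type*} [Fintype V] [DecidableEq V] {d : ℕ}
    (up rs mp : (Fin d → ℝ) → (Fin d → ℝ)) (F : (Fin d → ℝ) → (Fin d → ℝ))
    (A : Matrix V V ℝ) (hA : ∀ v u, 0 ≤ A v u)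
    (cup crs cmp cF kh kF : ℝ)
    (hupDiff : Differentiable ℝ up) (hrsDiff : Differentiable ℝ rs)
    (hmpDiff : Differentiable ℝ mp) (hFDiff : Differentiable ℝ F)
    (hup : ∀ (y : Fin d → ℝ) (p : Fin d), ∑ q, |fderiv ℝ up y (Pi.single q 1) p| ≤ cup)
    (hrs : ∀ (y : Fin d → ℝ) (p : Fin d), ∑ q, |fderiv ℝ rs y (Pi.single q 1) p| ≤ crs)
    (hmp : ∀ (y : Fin d → ℝ) (p : Fin d), ∑ q, |fderiv ℝ mp y (Pi.single q 1) p| ≤ cmp)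
    (hF : ∀ y : Fin d → ℝ, ∑ p, ∑ q, |fderiv ℝ F y (Pi.single q 1) p| ≤ cF)
    (hFrange : ∀ (y : Fin d → ℝ) (q : Fin d), |F y q| ≤ kF)
    (h0 : V → Fin d → ℝ)
    (hkh : ∀ (ℓ : ℕ) (u : V) (q : Fin d), |ampIter up rs mp F A ℓ h0 u q| ≤ kh)
    (m : ℕ) (hm : 1 ≤ m) :
    (∀ ℓ : ℕ,
      (∀ (v u : V) (α β : Fin d),
        |fderiv ℝ (fun h : V → Fin d → ℝ => ampIter up rs mp F A ℓ h v α) h0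
            (Pi.single u (Pi.single β 1))| ≤
          cup ^ ℓ * (((crs • (1 : Matrix V V ℝ) + (cmp * (cF * kh + kF)) • A) ^ ℓ) v u)) →
      (∀ (v u : V) (α β : Fin d),
        |fderiv ℝ (fun h : V → Fin d → ℝ => ampIter up rs mp F A (ℓ + 1) h v α) h0
            (Pi.single u (Pi.single β 1))| ≤
          cup ^ (ℓ + 1) *
            (((crs • (1 : Matrix V V ℝ) + (cmp * (cF * kh + kF)) • A) ^ (ℓ + 1)) v u))) ∧
    (∀ v u : V,
      (∑ α : Fin d, ∑ β : Fin d,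
          |fderiv ℝ (fun h : V → Fin d → ℝ => ampIter up rs mp F A m h v α) h0
            (Pi.single u (Pi.single β 1))|) ≤
        d * (((cup • (crs • (1 : Matrix V V ℝ) + (cmp * (cF * kh + kF)) • A)) ^ m) v u)) := by
  set M : Matrix V V ℝ := crs • (1 : Matrix V V ℝ) + (cmp * (cF * kh + kF)) • A with hM
  have hdiff := differentiable_ampIter A hupDiff hrsDiff hmpDiff hFDiff
  simp_rw [fun ℓ => fderiv_apply_apply (hdiff ℓ h0)]
  have hstep : ∀ (ℓ : ℕ) (u : V) {ι : Type} [Fintype ι] (w : ι → V → Fin d → ℝ),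
      (∀ v α, ∑ i, |fderiv ℝ (ampIter up rs mp F A ℓ) h0 (w i) v α| ≤
        cup ^ ℓ * (M ^ ℓ) v u) →
      ∀ v α, ∑ i, |fderiv ℝ (ampIter up rs mp F A (ℓ + 1)) h0 (w i) v α| ≤
        cup ^ (ℓ + 1) * (M ^ (ℓ + 1)) v u := by
    intro ℓ u ι _ w hw v α
    simp_rw [fderiv_ampIter_succ A hupDiff hrsDiff hmpDiff hFDiff]
    refine (sum_abs_fderiv_ampLayer_le A hA hupDiff hrsDiff hmpDiff hFDiff hup hrs hmp hF
      hFrange _ (hkh ℓ) _ _ hw v α).trans_eq ?_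
    rw [← hM, pow_succ' M, Matrix.mul_apply, pow_succ', mul_assoc, Finset.mul_sum (a := cup ^ ℓ)]
    congr 1
    refine Finset.sum_congr rfl fun u' _ => ?_
    ring
  refine ⟨fun ℓ hℓ v u α β => ?_, fun v u => ?_⟩
  · simpa using hstep ℓ u (fun _ : Unit => Pi.single u (Pi.single β 1))
      (fun v α => by simpa using hℓ v u α β) v α
  · have hrow : ∀ (ℓ : ℕ) (v : V) (α : Fin d),
        ∑ β, |fderiv ℝ (ampIter up rs mp F A ℓ) h0 (Pi.single u (Pi.single β 1)) v α| ≤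
          cup ^ ℓ * (M ^ ℓ) v u := by
      intro ℓ
      induction ℓ with
      | zero =>
        intro v α
        have hid : fderiv ℝ (ampIter up rs mp F A 0) h0 =
            ContinuousLinearMap.id ℝ (V → Fin d → ℝ) := fderiv_id
        rw [hid]
        by_cases hvu : v = u
        · subst hvu
          simp [Pi.single_apply, apply_ite abs]
        · simp [hvu]
      | succ ℓ ih => exact hstep ℓ u _ ih
    calc ∑ α, ∑ β, |fderiv ℝ (ampIter up rs mp F A m) h0 (Pi.single u (Pi.single β 1)) v α|
        ≤ ∑ _α : Fin d, cup ^ m * (M ^ m) v u := Finset.sum_le_sum fun α _ => hrow m v α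
      _ = d * ((cup • M) ^ m) v u := by
        simp [smul_pow]
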